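/- arXiv:1607.00232 — 4 statements merged into one kernel-verified Lean document; each statement's English description precedes it below -/
import Mathlib

section
/- If α > λ₁, then inf{E(a,φ) : (a,φ) a degree-d field pair} < 0. In particular, since every degree-d field pair of the form (a, 0) with F(a) = F₀ has E(a,0) = 0, no such reducible pair minimizes E. -/
open MeasureTheory Complex

noncomputable section

/-- Partial derivative in the first coordinate direction. -/
def pd1 {E : Type*} [NormedAddCommGroup E] [NormedSpace ℝ E]
    (f : ℝ × ℝ → E) (x : ℝ × ℝ) : E := fderiv ℝ f x (1, 0)

/-- Partial derivative in the second coordinate direction. -/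
def pd2 {E : Type*} [NormedAddCommGroup E] [NormedSpace ℝ E]
    (f : ℝ × ℝ → E) (x : ℝ × ℝ) : E := fderiv ℝ f x (0, 1)

/-- Covariant derivative `D₁φ = ∂₁φ + i a₁ φ`. -/
def D1 (a1 : ℝ × ℝ → ℝ) (φ : ℝ × ℝ → ℂ) : ℝ × ℝ → ℂ :=
  fun x => pd1 φ x + Complex.I * (a1 x : ℂ) * φ x

/-- Covariant derivative `D₂φ = ∂₂φ + i a₂ φ`. -/
def D2 (a2 : ℝ × ℝ → ℝ) (φ : ℝ × ℝ → ℂ) : ℝ × ℝ → ℂ :=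
  fun x => pd2 φ x + Complex.I * (a2 x : ℂ) * φ x

/-- Curvature `F(a) = ∂₁a₂ − ∂₂a₁`. -/
def curv (a1 a2 : ℝ × ℝ → ℝ) : ℝ × ℝ → ℝ :=
  fun x => pd1 a2 x - pd2 a1 x

/-- The fundamental domain `[0,1]²`. -/
def unitSquare : Set (ℝ × ℝ) := Set.Icc (0, 0) (1, 1)

/-- A degree-`d` field pair on the torus: smooth quasi-periodic `(a, φ)`. -/
structure FieldPair (d : ℤ) where
  a1 : ℝ × ℝ → ℝ
  a2 : ℝ × ℝ → ℝ
  φ : ℝ × ℝ → ℂ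
  smooth_a1 : ContDiff ℝ (⊤ : ℕ∞) a1
  smooth_a2 : ContDiff ℝ (⊤ : ℕ∞) a2
  smooth_φ : ContDiff ℝ (⊤ : ℕ∞) φ
  per1_a1 : ∀ x : ℝ × ℝ, a1 (x.1 + 1, x.2) = a1 x
  per1_a2 : ∀ x : ℝ × ℝ, a2 (x.1 + 1, x.2) = a2 x
  per1_φ : ∀ x : ℝ × ℝ, φ (x.1 + 1, x.2) = φ x
  per2_a2 : ∀ x : ℝ × ℝ, a2 (x.1, x.2 + 1) = a2 x
  per2_a1 : ∀ x : ℝ × ℝ, a1 (x.1, x.2 + 1) = a1 x - 2 * Real.pi * d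
  per2_φ : ∀ x : ℝ × ℝ, φ (x.1, x.2 + 1) =
      Complex.exp (2 * Real.pi * Complex.I * (d : ℂ) * (x.1 : ℂ)) * φ x

/-- The smooth ℤ²-periodic external field with `∫_{[0,1]²} F₀ = 2πd`. -/
def ExternalField (d : ℤ) (F₀ : ℝ × ℝ → ℝ) : Prop :=
  ContDiff ℝ (⊤ : ℕ∞) F₀ ∧ (∀ x : ℝ × ℝ, F₀ (x.1 + 1, x.2) = F₀ x) ∧
    (∀ x : ℝ × ℝ, F₀ (x.1, x.2 + 1) = F₀ x) ∧
    (∫ x in unitSquare, F₀ x) = 2 * Real.pi * d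

/-- The Ginzburg–Landau free energy. -/
def energy (α β : ℝ) (F₀ : ℝ × ℝ → ℝ) {d : ℤ} (P : FieldPair d) : ℝ :=
  (1 / 2) * ∫ x in unitSquare,
    ((curv P.a1 P.a2 x - F₀ x) ^ 2 + ‖D1 P.a1 P.φ x‖ ^ 2 + ‖D2 P.a2 P.φ x‖ ^ 2
      - α * ‖P.φ x‖ ^ 2 + (β / 2) * ‖P.φ x‖ ^ 4)

/-- The Ginzburg–Landau equations. -/
def IsGLSolution (α β : ℝ) (F₀ : ℝ × ℝ → ℝ) {d : ℤ} (P : FieldPair d) : Prop :=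
  (∀ x : ℝ × ℝ,
      pd2 (fun y => curv P.a1 P.a2 y - F₀ y) x
        + ((starRingEnd ℂ) (P.φ x) * D1 P.a1 P.φ x).im = 0) ∧
  (∀ x : ℝ × ℝ,
      -pd1 (fun y => curv P.a1 P.a2 y - F₀ y) x
        + ((starRingEnd ℂ) (P.φ x) * D2 P.a2 P.φ x).im = 0) ∧
  (∀ x : ℝ × ℝ,
      -(D1 P.a1 (D1 P.a1 P.φ) x + D2 P.a2 (D2 P.a2 P.φ) x)
        = (α : ℂ) * P.φ x - (β : ℂ) * (‖P.φ x‖ : ℂ) ^ 2 * P.φ x)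

/-- The set of energies of all degree-`d` field pairs. -/
def energySet (α β : ℝ) (F₀ : ℝ × ℝ → ℝ) (d : ℤ) : Set ℝ :=
  { t : ℝ | ∃ P : FieldPair d, t = energy α β F₀ P }

/-- `λ₁`, the lowest eigenvalue of the covariant Laplacian among connections
with curvature `F₀`. -/
def lambda1 (d : ℤ) (F₀ : ℝ × ℝ → ℝ) : ℝ :=
  sInf { t : ℝ | ∃ P : FieldPair d,
    (∀ x : ℝ × ℝ, curv P.a1 P.a2 x = F₀ x) ∧
    (∫ x in unitSquare, ‖P.φ x‖ ^ 2) = 1 ∧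
    t = ∫ x in unitSquare, (‖D1 P.a1 P.φ x‖ ^ 2 + ‖D2 P.a2 P.φ x‖ ^ 2) }

theorem hasFDerivAt_intervalIntegral_of_contDiff {H E : Type} [NormedAddCommGroup H]
    [NormedSpace ℝ H] [FiniteDimensional ℝ H] [NormedAddCommGroup E] [NormedSpace ℝ E]
    (a b : ℝ) {f : H × ℝ → E} (hf : ContDiff ℝ 1 f) (x₀ : H) :
    HasFDerivAt (fun x => ∫ t in a..b, f (x, t))
      (∫ t in a..b, (fderiv ℝ f (x₀, t)).comp (ContinuousLinearMap.inl ℝ H ℝ)) x₀ := by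
  have hf' : Continuous fun p : H × ℝ =>
      (fderiv ℝ f p).comp (ContinuousLinearMap.inl ℝ H ℝ) :=
    (hf.continuous_fderiv one_ne_zero).clm_comp continuous_const
  have : ProperSpace H := FiniteDimensional.proper_real H
  obtain ⟨C, hC⟩ := ((isCompact_closedBall x₀ 1).prod
    (isCompact_uIcc (a := a) (b := b))).exists_bound_of_continuousOn hf'.continuousOn
  refine intervalIntegral.hasFDerivAt_integral_of_dominated_of_fderiv_le
    (F := fun x t => f (x, t))
    (F' := fun x t => (fderiv ℝ f (x, t)).comp (ContinuousLinearMap.inl ℝ H ℝ))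
    (bound := fun _ => C) (Metric.closedBall_mem_nhds x₀ one_pos) ?_ ?_ ?_ ?_ ?_ ?_
  · exact Filter.Eventually.of_forall fun x =>
      (hf.continuous.comp (Continuous.prodMk_right x)).aestronglyMeasurable
  · exact (hf.continuous.comp (Continuous.prodMk_right x₀)).intervalIntegrable _ _
  · exact (hf'.comp (Continuous.prodMk_right x₀)).aestronglyMeasurable
  · exact Filter.Eventually.of_forall fun t ht x hx =>
      hC (x, t) ⟨hx, Set.uIoc_subset_uIcc ht⟩
  · exact intervalIntegrable_const
  · refine Filter.Eventually.of_forall fun t _ x _ => ?_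
    exact ((hf.differentiable one_ne_zero) (x, t)).hasFDerivAt.comp x
      (hasFDerivAt_prodMk_left x t)

theorem contDiff_nat_intervalIntegral {H : Type} [NormedAddCommGroup H]
    [NormedSpace ℝ H] [FiniteDimensional ℝ H] (a b : ℝ) (n : ℕ) :
    ∀ {E : Type} [NormedAddCommGroup E] [NormedSpace ℝ E] {f : H × ℝ → E},
      ContDiff ℝ (⊤ : ℕ∞) f → ContDiff ℝ n fun x => ∫ t in a..b, f (x, t) := by
  induction n with
  | zero =>
    intro E _ _ f hf
    refine contDiff_zero.2 (continuous_iff_continuousAt.2 fun x => ?_)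
    exact (hasFDerivAt_intervalIntegral_of_contDiff a b (hf.of_le (by simp)) x).continuousAt
  | succ n ih =>
    intro E _ _ f hf
    refine contDiff_succ_iff_hasFDerivAt.2 ⟨_, ?_, fun x =>
      hasFDerivAt_intervalIntegral_of_contDiff a b (hf.of_le (by simp)) x⟩
    exact ih ((hf.fderiv_right le_rfl).clm_comp contDiff_const)

/-- Smooth dependence of an interval integral on a parameter. -/
theorem contDiff_intervalIntegral {H E : Type} [NormedAddCommGroup H]
    [NormedSpace ℝ H] [FiniteDimensional ℝ H] [NormedAddCommGroup E] [NormedSpace ℝ E]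
    (a b : ℝ) {f : H × ℝ → E} (hf : ContDiff ℝ (⊤ : ℕ∞) f) :
    ContDiff ℝ (⊤ : ℕ∞) fun x => ∫ t in a..b, f (x, t) :=
  contDiff_infty.2 fun n => contDiff_nat_intervalIntegral a b n hf

/-- Smoothness of a primitive in the first variable. -/
theorem contDiff_primitive {f : ℝ × ℝ → ℝ} (hf : ContDiff ℝ (⊤ : ℕ∞) f) :
    ContDiff ℝ (⊤ : ℕ∞) fun x : ℝ × ℝ => ∫ s in (0 : ℝ)..x.1, f (s, x.2) := by
  have key : (fun x : ℝ × ℝ => ∫ s in (0 : ℝ)..x.1, f (s, x.2)) =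
      fun x : ℝ × ℝ => x.1 * ∫ t in (0 : ℝ)..1, f (x.1 * t, x.2) := by
    funext x
    simpa using (intervalIntegral.mul_integral_comp_mul_left
      (f := fun s => f (s, x.2)) (a := 0) (b := 1) x.1).symm
  rw [key]
  refine contDiff_fst.mul (contDiff_intervalIntegral (H := ℝ × ℝ) 0 1
    (f := fun p => f (p.1.1 * p.2, p.1.2)) (hf.comp ?_))
  fun_prop

theorem pd1_eq_of_hasDerivAt {f : ℝ × ℝ → ℝ} {x : ℝ × ℝ} {c : ℝ}
    (hf : DifferentiableAt ℝ f x) (h : HasDerivAt (fun s => f (s, x.2)) c x.1) :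
    pd1 f x = c :=
  (hf.hasFDerivAt.comp_hasDerivAt x.1
    ((hasDerivAt_id x.1).prodMk (hasDerivAt_const x.1 x.2))).unique h

theorem pd2_eq_of_hasDerivAt {f : ℝ × ℝ → ℝ} {x : ℝ × ℝ} {c : ℝ}
    (hf : DifferentiableAt ℝ f x) (h : HasDerivAt (fun s => f (x.1, s)) c x.2) :
    pd2 f x = c :=
  (hf.hasFDerivAt.comp_hasDerivAt x.2
    ((hasDerivAt_const x.2 x.1).prodMk (hasDerivAt_id x.2))).unique h

/-- Fubini on the unit square. -/
theorem integral_unitSquare {f : ℝ × ℝ → ℝ} (hf : Continuous f) :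
    ∫ x in unitSquare, f x = ∫ t in (0 : ℝ)..1, ∫ s in (0 : ℝ)..1, f (s, t) := by
  have hint : IntegrableOn f (Set.Icc (0 : ℝ) 1 ×ˢ Set.Icc (0 : ℝ) 1)
      ((volume : Measure ℝ).prod volume) :=
    hf.continuousOn.integrableOn_compact (isCompact_Icc.prod isCompact_Icc)
  have hsq : unitSquare = Set.Icc (0 : ℝ) 1 ×ˢ Set.Icc (0 : ℝ) 1 := by
    rw [unitSquare, Set.Icc_prod_eq]
  rw [hsq, Measure.volume_eq_prod, ← Measure.prod_restrict, integral_prod_symm,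
    intervalIntegral.integral_of_le zero_le_one, integral_Icc_eq_integral_Ioc]
  · simp_rw [intervalIntegral.integral_of_le zero_le_one, integral_Icc_eq_integral_Ioc]
  · rwa [Measure.prod_restrict]

/-- Every admissible external field is the curvature of a connection of degree `d`. -/
theorem exists_connection_of_externalField {d : ℤ} {F₀ : ℝ × ℝ → ℝ}
    (hF₀ : ExternalField d F₀) : ∃ a1 a2 : ℝ × ℝ → ℝ,
      ContDiff ℝ (⊤ : ℕ∞) a1 ∧ ContDiff ℝ (⊤ : ℕ∞) a2 ∧
      (∀ x : ℝ × ℝ, a1 (x.1 + 1, x.2) = a1 x) ∧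
      (∀ x : ℝ × ℝ, a2 (x.1 + 1, x.2) = a2 x) ∧
      (∀ x : ℝ × ℝ, a2 (x.1, x.2 + 1) = a2 x) ∧
      (∀ x : ℝ × ℝ, a1 (x.1, x.2 + 1) = a1 x - 2 * Real.pi * d) ∧
      ∀ x, curv a1 a2 x = F₀ x := by
  obtain ⟨hs, hp1, hp2, hint⟩ := hF₀
  set g : ℝ → ℝ := fun t => ∫ s in (0 : ℝ)..1, F₀ (s, t) with hg
  have hgs : ContDiff ℝ (⊤ : ℕ∞) g :=
    contDiff_intervalIntegral 0 1 (f := fun p : ℝ × ℝ => F₀ (p.2, p.1))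
      (hs.comp (contDiff_snd.prodMk contDiff_fst))
  have hgp : Function.Periodic g 1 := fun t => by
    simp only [hg]
    exact intervalIntegral.integral_congr fun s _ => hp2 (s, t)
  have hgi : ∀ u v, IntervalIntegrable g volume u v :=
    fun u v => hgs.continuous.intervalIntegrable u v
  have hdiff : ContDiff ℝ (⊤ : ℕ∞) fun x : ℝ × ℝ => F₀ x - g x.2 :=
    hs.sub (hgs.comp contDiff_snd)
  have hdc : ∀ t, Continuous fun s => F₀ (s, t) - g t := fun t =>
    hdiff.continuous.comp (Continuous.prodMk_left t)
  have hFc : ∀ t, Continuous fun s => F₀ (s, t) := fun t =>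
    hs.continuous.comp (Continuous.prodMk_left t)
  have hs1 : ContDiff ℝ (⊤ : ℕ∞) fun x : ℝ × ℝ => -∫ t in (0 : ℝ)..x.2, g t :=
    ((contDiff_primitive (hgs.comp contDiff_fst)).comp
      (contDiff_snd.prodMk contDiff_fst)).neg
  have hs2 : ContDiff ℝ (⊤ : ℕ∞) fun x : ℝ × ℝ =>
      ∫ s in (0 : ℝ)..x.1, (F₀ (s, x.2) - g x.2) := contDiff_primitive hdiff
  refine ⟨_, _, hs1, hs2, fun x => rfl, fun x => ?_, fun x => ?_, fun x => ?_, fun x => ?_⟩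
  · have hper : Function.Periodic (fun s => F₀ (s, x.2) - g x.2) 1 := fun s => by
      have := hp1 (s, x.2)
      simp_all
    have h0 : ∫ s in (0 : ℝ)..1, (F₀ (s, x.2) - g x.2) = 0 := by
      rw [intervalIntegral.integral_sub ((hFc _).intervalIntegrable _ _)
        intervalIntegrable_const]
      simp [hg]
    have h1 := hper.intervalIntegral_add_eq x.1 0
    rw [zero_add, h0] at h1
    have h2 := intervalIntegral.integral_add_adjacent_intervals
      ((hdc x.2).intervalIntegrable (μ := volume) 0 x.1)
      ((hdc x.2).intervalIntegrable (μ := volume) x.1 (x.1 + 1))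
    simp only [h1, add_zero] at h2
    exact h2.symm
  · refine intervalIntegral.integral_congr fun s _ => ?_
    have := hp2 (s, x.2)
    have := hgp x.2
    simp_all
  · have h1 := hgp.intervalIntegral_add_eq x.2 0
    rw [zero_add, ← integral_unitSquare hs.continuous, hint] at h1
    have h2 := intervalIntegral.integral_add_adjacent_intervals (hgi 0 x.2) (hgi x.2 (x.2 + 1))
    simp only
    linarith
  · have e1 := pd2_eq_of_hasDerivAt (hs1.differentiable (by simp) x)
      (intervalIntegral.integral_hasDerivAt_right (hgi 0 x.2)
        (hgs.continuous.stronglyMeasurableAtFilter _ _) hgs.continuous.continuousAt).neg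
    have e2 := pd1_eq_of_hasDerivAt (hs2.differentiable (by simp) x)
      (intervalIntegral.integral_hasDerivAt_right
        ((hdc x.2).intervalIntegrable 0 x.1)
        ((hdc x.2).stronglyMeasurableAtFilter _ _) (hdc x.2).continuousAt)
    rw [curv, e1, e2]
    ring

/-- The line bundle of degree `d` has a smooth section which is not identically zero. -/
theorem exists_section (d : ℤ) : ∃ φ : ℝ × ℝ → ℂ, ContDiff ℝ (⊤ : ℕ∞) φ ∧
    (∀ x : ℝ × ℝ, φ (x.1 + 1, x.2) = φ x) ∧
    (∀ x : ℝ × ℝ, φ (x.1, x.2 + 1) =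
      Complex.exp (2 * Real.pi * Complex.I * (d : ℂ) * (x.1 : ℂ)) * φ x) ∧
    φ (1 / 2, 1 / 2) ≠ 0 := by
  let χ : ContDiffBump (1 / 2 : ℝ) := ⟨1 / 8, 1 / 4, by norm_num, by norm_num⟩
  have hχ : ∀ t : ℝ, 1 / 4 ≤ |t - 1 / 2| → χ t = 0 := fun t ht =>
    χ.zero_of_le_dist (by simpa [χ, Real.dist_eq] using ht)
  refine ⟨fun x => Complex.exp (2 * Real.pi * Complex.I * (d : ℂ) * (⌊x.2⌋ : ℂ) * (x.1 : ℂ))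
    * (χ (Int.fract x.2) : ℂ), ?_, fun x => ?_, fun x => ?_, ?_⟩
  · refine contDiff_iff_contDiffAt.2 fun x => ?_
    by_cases hx : Int.fract x.2 = 0
    · refine (contDiffAt_const (c := (0 : ℂ))).congr_of_eventuallyEq ?_
      have hnear : ∀ᶠ y : ℝ × ℝ in nhds x, |y.2 - x.2| < 1 / 4 :=
        (continuous_snd.sub continuous_const).abs.continuousAt.eventually_lt
          continuousAt_const (by norm_num)
      filter_upwards [hnear] with y hy
      have hx' : (⌊x.2⌋ : ℝ) = x.2 := by linarith [Int.self_sub_floor x.2]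
      rw [hχ, Complex.ofReal_zero, mul_zero]
      by_contra! hlt
      rw [abs_lt] at hlt hy
      rw [← hx', Int.fract] at *
      have h1 : (⌊x.2⌋ : ℝ) < ⌊y.2⌋ + 1 := by linarith
      have h2 : (⌊y.2⌋ : ℝ) < ⌊x.2⌋ := by linarith
      norm_cast at h1 h2
      omega
    · have hx0 : (⌊x.2⌋ : ℝ) < x.2 := by
        have := (Int.fract_nonneg x.2).lt_of_ne' hx
        rw [Int.fract] at this
        linarith
      have hsm : ContDiff ℝ (⊤ : ℕ∞) fun y : ℝ × ℝ =>
          Complex.exp (2 * Real.pi * Complex.I * (d : ℂ) * (⌊x.2⌋ : ℂ) * (y.1 : ℂ))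
            * (χ (y.2 - ⌊x.2⌋) : ℂ) := by
        refine (ContDiff.cexp (contDiff_const.mul
          (Complex.ofRealCLM.contDiff.comp contDiff_fst))).mul
          (Complex.ofRealCLM.contDiff.comp
            (χ.contDiff.comp (contDiff_snd.sub contDiff_const)))
      refine hsm.contDiffAt.congr_of_eventuallyEq ?_
      have hlo : ∀ᶠ y : ℝ × ℝ in nhds x, (⌊x.2⌋ : ℝ) < y.2 :=
        continuousAt_const.eventually_lt continuous_snd.continuousAt hx0
      have hhi : ∀ᶠ y : ℝ × ℝ in nhds x, y.2 < ⌊x.2⌋ + 1 :=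
        continuous_snd.continuousAt.eventually_lt continuousAt_const (Int.lt_floor_add_one _)
      filter_upwards [hlo, hhi] with y h1 h2
      have : ⌊y.2⌋ = ⌊x.2⌋ := Int.floor_eq_iff.2 ⟨h1.le, h2⟩
      simp only [Int.fract, this]
  · have : 2 * Real.pi * Complex.I * (d : ℂ) * (⌊x.2⌋ : ℂ) * ((x.1 + 1 : ℝ) : ℂ) =
        2 * Real.pi * Complex.I * (d : ℂ) * (⌊x.2⌋ : ℂ) * (x.1 : ℂ) +
          ((d * ⌊x.2⌋ : ℤ) : ℂ) * (2 * Real.pi * Complex.I) := by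
      push_cast
      ring
    simp only [this, Complex.exp_add, Complex.exp_int_mul_two_pi_mul_I, mul_one]
  · simp only [Int.floor_add_one, Int.fract_add_one]
    rw [← mul_assoc, ← Complex.exp_add]
    congr 2
    push_cast
    ring
  · have : χ (Int.fract (1 / 2 : ℝ)) = 1 := by
      rw [Int.fract_eq_self.2 (by norm_num)]
      exact χ.one_of_mem_closedBall (by simp [χ])
    simp [-one_div, this]

theorem isCompact_unitSquare : IsCompact unitSquare := isCompact_Icc

theorem Continuous.integrableOn_unitSquare {f : ℝ × ℝ → ℝ} (hf : Continuous f) :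
    IntegrableOn f unitSquare :=
  hf.continuousOn.integrableOn_compact isCompact_unitSquare

theorem integral_unitSquare_pos {f : ℝ × ℝ → ℝ} (hf : Continuous f) (h0 : ∀ x, 0 ≤ f x)
    (h : f (1 / 2, 1 / 2) ≠ 0) : 0 < ∫ x in unitSquare, f x := by
  rw [setIntegral_pos_iff_support_of_nonneg_ae (Filter.Eventually.of_forall h0)
    hf.integrableOn_unitSquare]
  have hopen : IsOpen (Function.support f ∩ Set.Ioo (0 : ℝ) 1 ×ˢ Set.Ioo (0 : ℝ) 1) :=
    hf.isOpen_support.inter (isOpen_Ioo.prod isOpen_Ioo)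
  refine (hopen.measure_pos volume ⟨(1 / 2, 1 / 2), h, ?_⟩).trans_le (measure_mono ?_)
  · norm_num
  · rintro x ⟨hx, h1, h2⟩
    exact ⟨hx, ⟨h1.1.le, h2.1.le⟩, ⟨h1.2.le, h2.2.le⟩⟩

namespace FieldPair

variable {d : ℤ}

/-- Rescale the section of a field pair by a real constant. -/
def scale (P : FieldPair d) (c : ℝ) : FieldPair d :=
  { P with
    φ := fun x => (c : ℂ) * P.φ x
    smooth_φ := contDiff_const.mul P.smooth_φ
    per1_φ := fun x => by rw [P.per1_φ]
    per2_φ := fun x => by rw [P.per2_φ]; ring }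

theorem D1_scale (P : FieldPair d) (c : ℝ) (x : ℝ × ℝ) :
    D1 (P.scale c).a1 (P.scale c).φ x = c * D1 P.a1 P.φ x := by
  have h : fderiv ℝ (fun y => (c : ℂ) * P.φ y) x = (c : ℂ) • fderiv ℝ P.φ x :=
    fderiv_const_mul (P.smooth_φ.differentiable (by simp) x) _
  simp only [D1, pd1, scale, h, _root_.smul_apply, smul_eq_mul]
  ring

theorem D2_scale (P : FieldPair d) (c : ℝ) (x : ℝ × ℝ) :
    D2 (P.scale c).a2 (P.scale c).φ x = c * D2 P.a2 P.φ x := by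
  have h : fderiv ℝ (fun y => (c : ℂ) * P.φ y) x = (c : ℂ) • fderiv ℝ P.φ x :=
    fderiv_const_mul (P.smooth_φ.differentiable (by simp) x) _
  simp only [D2, pd2, scale, h, _root_.smul_apply, smul_eq_mul]
  ring

theorem norm_scale (P : FieldPair d) (c : ℝ) (x : ℝ × ℝ) :
    ‖(P.scale c).φ x‖ = |c| * ‖P.φ x‖ := by
  simp [scale]

theorem continuous_D1 (P : FieldPair d) : Continuous (D1 P.a1 P.φ) :=
  ((P.smooth_φ.continuous_fderiv (by simp)).clm_apply continuous_const).add
    ((continuous_const.mul (Complex.continuous_ofReal.comp P.smooth_a1.continuous)).mul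
      P.smooth_φ.continuous)

theorem continuous_D2 (P : FieldPair d) : Continuous (D2 P.a2 P.φ) :=
  ((P.smooth_φ.continuous_fderiv (by simp)).clm_apply continuous_const).add
    ((continuous_const.mul (Complex.continuous_ofReal.comp P.smooth_a2.continuous)).mul
      P.smooth_φ.continuous)

theorem continuous_curv (P : FieldPair d) : Continuous (curv P.a1 P.a2) :=
  ((P.smooth_a2.continuous_fderiv (by simp)).clm_apply continuous_const).sub
    ((P.smooth_a1.continuous_fderiv (by simp)).clm_apply continuous_const)

end FieldPair

/-- There is a normalised field pair with prescribed curvature. -/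
theorem exists_normalized_fieldPair {d : ℤ} {F₀ : ℝ × ℝ → ℝ} (hF₀ : ExternalField d F₀) :
    ∃ P : FieldPair d, (∀ x, curv P.a1 P.a2 x = F₀ x) ∧
      ∫ x in unitSquare, ‖P.φ x‖ ^ 2 = 1 := by
  obtain ⟨a1, a2, hs1, hs2, h11, h12, h22, h21, hcurv⟩ := exists_connection_of_externalField hF₀
  obtain ⟨φ, hφ, hφ1, hφ2, hne⟩ := exists_section d
  let P : FieldPair d := ⟨a1, a2, φ, hs1, hs2, hφ, h11, h12, hφ1, h22, h21, hφ2⟩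
  have hN : 0 < ∫ x in unitSquare, ‖φ x‖ ^ 2 :=
    integral_unitSquare_pos (hφ.continuous.norm.pow 2) (fun x => sq_nonneg _) (by simpa using hne)
  refine ⟨P.scale (√(∫ x in unitSquare, ‖φ x‖ ^ 2))⁻¹, hcurv, ?_⟩
  simp_rw [FieldPair.norm_scale, mul_pow, sq_abs, integral_const_mul, inv_pow,
    Real.sq_sqrt hN.le]
  exact inv_mul_cancel₀ hN.ne'

theorem energy_scale {d : ℤ} (α β : ℝ) {F₀ : ℝ × ℝ → ℝ} {P : FieldPair d}
    (hP : ∀ x, curv P.a1 P.a2 x = F₀ x) (hP1 : ∫ x in unitSquare, ‖P.φ x‖ ^ 2 = 1) (c : ℝ) :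
    energy α β F₀ (P.scale c) = (1 / 2) * (c ^ 2 *
      ((∫ x in unitSquare, (‖D1 P.a1 P.φ x‖ ^ 2 + ‖D2 P.a2 P.φ x‖ ^ 2)) - α)
        + c ^ 4 * ((β / 2) * ∫ x in unitSquare, ‖P.φ x‖ ^ 4)) := by
  have hφ := P.smooth_φ.continuous
  have hD : IntegrableOn (fun x => ‖D1 P.a1 P.φ x‖ ^ 2 + ‖D2 P.a2 P.φ x‖ ^ 2) unitSquare :=
    ((P.continuous_D1.norm.pow 2).add (P.continuous_D2.norm.pow 2)).integrableOn_unitSquare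
  have h2 : IntegrableOn (fun x => ‖P.φ x‖ ^ 2) unitSquare :=
    (hφ.norm.pow 2).integrableOn_unitSquare
  have h4 : IntegrableOn (fun x => ‖P.φ x‖ ^ 4) unitSquare :=
    (hφ.norm.pow 4).integrableOn_unitSquare
  have hc : ∀ x, curv (P.scale c).a1 (P.scale c).a2 x = F₀ x := hP
  have hfun : ∀ x, (curv (P.scale c).a1 (P.scale c).a2 x - F₀ x) ^ 2
      + ‖D1 (P.scale c).a1 (P.scale c).φ x‖ ^ 2 + ‖D2 (P.scale c).a2 (P.scale c).φ x‖ ^ 2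
      - α * ‖(P.scale c).φ x‖ ^ 2 + (β / 2) * ‖(P.scale c).φ x‖ ^ 4 =
      c ^ 2 * (‖D1 P.a1 P.φ x‖ ^ 2 + ‖D2 P.a2 P.φ x‖ ^ 2) - c ^ 2 * α * ‖P.φ x‖ ^ 2
        + c ^ 4 * (β / 2) * ‖P.φ x‖ ^ 4 := fun x => by
    rw [hc, P.D1_scale, P.D2_scale, P.norm_scale, norm_mul, norm_mul, Complex.norm_real,
      Real.norm_eq_abs]
    simp only [mul_pow, sq_abs, Even.pow_abs (show Even 4 by decide)]
    ring
  simp only [energy, hfun]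
  have hsub : IntegrableOn (fun x => c ^ 2 * (‖D1 P.a1 P.φ x‖ ^ 2 + ‖D2 P.a2 P.φ x‖ ^ 2)
      - c ^ 2 * α * ‖P.φ x‖ ^ 2) unitSquare := (hD.const_mul _).sub (h2.const_mul _)
  rw [integral_add hsub (h4.const_mul _),
    integral_sub (hD.const_mul _) (h2.const_mul _), integral_const_mul, integral_const_mul,
    integral_const_mul, hP1]
  ring

theorem bddBelow_energySet (α : ℝ) {β : ℝ} (hβ : 0 < β) {F₀ : ℝ × ℝ → ℝ}
    (hF₀ : Continuous F₀) (d : ℤ) : BddBelow (energySet α β F₀ d) := by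
  refine ⟨(1 / 2) * ∫ _ in unitSquare, -(α ^ 2 / (2 * β)), ?_⟩
  rintro _ ⟨P, rfl⟩
  have hφ := P.smooth_φ.continuous
  refine mul_le_mul_of_nonneg_left (integral_mono continuous_const.integrableOn_unitSquare
    ?_ fun x => ?_) (by norm_num)
  · exact (((((P.continuous_curv.sub hF₀).pow 2).add (P.continuous_D1.norm.pow 2)).add
      (P.continuous_D2.norm.pow 2)).sub (continuous_const.mul (hφ.norm.pow 2))).add
      (continuous_const.mul (hφ.norm.pow 4)) |>.integrableOn_unitSquare
  · have key : -α * ‖P.φ x‖ ^ 2 + (β / 2) * ‖P.φ x‖ ^ 4 + α ^ 2 / (2 * β) =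
        (β * ‖P.φ x‖ ^ 2 - α) ^ 2 / (2 * β) := by
      field_simp
      ring
    have h0 : 0 ≤ (β * ‖P.φ x‖ ^ 2 - α) ^ 2 / (2 * β) := by positivity
    have h1 := sq_nonneg (curv P.a1 P.a2 x - F₀ x)
    have h2 := sq_nonneg ‖D1 P.a1 P.φ x‖
    have h3 := sq_nonneg ‖D2 P.a2 P.φ x‖
    simp only
    linarith

/-- A field pair with vanishing section and curvature `F₀` has zero energy. -/
theorem energy_eq_zero_of_reducible (α β : ℝ) {d : ℤ} {F₀ : ℝ × ℝ → ℝ} {P : FieldPair d}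
    (h0 : ∀ x, P.φ x = 0) (hc : ∀ x, curv P.a1 P.a2 x = F₀ x) : energy α β F₀ P = 0 := by
  have hφ : P.φ = fun _ => 0 := funext h0
  simp [energy, hc, D1, D2, pd1, pd2, hφ]

/-- if `α > λ₁` then the infimum of the energy is negative; in particular
every reducible pair `(a,0)` with `F(a) = F₀` has zero energy and does not minimize. -/
theorem statement2 (α β : ℝ) (hα : 0 < α) (hβ : 0 < β) (d : ℤ) (F₀ : ℝ × ℝ → ℝ)
    (hF₀ : ExternalField d F₀) (h : α > lambda1 d F₀) :
    sInf (energySet α β F₀ d) < 0 ∧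
    ∀ P : FieldPair d, (∀ x : ℝ × ℝ, P.φ x = 0) →
      (∀ x : ℝ × ℝ, curv P.a1 P.a2 x = F₀ x) →
      energy α β F₀ P = 0 ∧ energy α β F₀ P ≠ sInf (energySet α β F₀ d) := by
  have hneg : sInf (energySet α β F₀ d) < 0 := by
    obtain ⟨P₀, hP₀, hP₀1⟩ := exists_normalized_fieldPair hF₀
    obtain ⟨_, ⟨P, hP, hP1, rfl⟩, hlt⟩ :=
      exists_lt_of_csInf_lt (by exact ⟨_, P₀, hP₀, hP₀1, rfl⟩) h
    have hscale := energy_scale α β hP hP1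
    have hB : 0 ≤ (β / 2) * ∫ x in unitSquare, ‖P.φ x‖ ^ 4 :=
      mul_nonneg (by positivity) (integral_nonneg fun x => by positivity)
    generalize (∫ x in unitSquare, (‖D1 P.a1 P.φ x‖ ^ 2 + ‖D2 P.a2 P.φ x‖ ^ 2)) = A at *
    generalize (β / 2) * (∫ x in unitSquare, ‖P.φ x‖ ^ 4) = B at *
    have hε : 0 < (α - A) / (B + 1) := div_pos (by linarith) (by linarith)
    have hεB : (α - A) / (B + 1) * (B + 1) = α - A := div_mul_cancel₀ _ (by linarith)
    generalize (α - A) / (B + 1) = ε at *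
    refine (csInf_le (bddBelow_energySet α hβ hF₀.1.continuous d)
      (⟨P.scale √ε, rfl⟩ : energy α β F₀ (P.scale √ε) ∈ energySet α β F₀ d)).trans_lt ?_
    rw [hscale, show √ε ^ 4 = (√ε ^ 2) ^ 2 by ring, Real.sq_sqrt hε.le]
    nlinarith [mul_pos hε hε]
  refine ⟨hneg, fun P h0 hc => ?_⟩
  have hE := energy_eq_zero_of_reducible α β h0 hc
  exact ⟨hE, hE ▸ hneg.ne'⟩
end
end

section
/- Suppose the external field F₀ is constant and max{α, α/(2β)} ≤ 2π|d|. Then there is no irreducible degree-d GL solution: every degree-d GL solution (a,φ) has φ identically zero. -/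
open MeasureTheory Complex

noncomputable section

section PartialDerivatives

variable {E : Type*} [NormedAddCommGroup E] [NormedSpace ℝ E]

lemma pd1_contDiff {f : ℝ × ℝ → E} (hf : ContDiff ℝ (⊤ : ℕ∞) f) :
    ContDiff ℝ (⊤ : ℕ∞) (pd1 f) :=
  (hf.fderiv_right (by norm_cast)).clm_apply contDiff_const

lemma pd2_contDiff {f : ℝ × ℝ → E} (hf : ContDiff ℝ (⊤ : ℕ∞) f) :
    ContDiff ℝ (⊤ : ℕ∞) (pd2 f) :=
  (hf.fderiv_right (by norm_cast)).clm_apply contDiff_const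

lemma pd1_pd2_comm {f : ℝ × ℝ → E} (hf : ContDiff ℝ (⊤ : ℕ∞) f) (x : ℝ × ℝ) :
    pd1 (pd2 f) x = pd2 (pd1 f) x := by
  have hd : DifferentiableAt ℝ (fderiv ℝ f) x :=
    ((hf.fderiv_right (m := (⊤ : ℕ∞)) (by norm_cast)).differentiable (by simp)) x
  have key (v w : ℝ × ℝ) :
      fderiv ℝ (fun y => fderiv ℝ f y w) x v = fderiv ℝ (fderiv ℝ f) x v w := by
    rw [fderiv_clm_apply hd (differentiableAt_const w)]
    simp
  have hs : IsSymmSndFDerivAt ℝ f x :=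
    hf.contDiffAt.isSymmSndFDerivAt (by simpa using WithTop.coe_le_coe.2 (le_top (α := ℕ∞) (a := 2)))
  unfold pd1 pd2
  rw [key, key]
  exact hs _ _

lemma fderiv_add_period {f : ℝ × ℝ → E} {e : ℝ × ℝ} {c : E}
    (h : ∀ x, f (x + e) = f x + c) (x : ℝ × ℝ) : fderiv ℝ f (x + e) = fderiv ℝ f x := by
  rw [← fderiv_comp_add_right, funext h, fderiv_add_const]

end PartialDerivatives

/-- Invariance under the translations by the lattice `ℤ²`. -/
def DoublyPeriodic {E : Type*} (f : ℝ × ℝ → E) : Prop :=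
  (∀ x, f (x + (1, 0)) = f x) ∧ ∀ x, f (x + (0, 1)) = f x

namespace DoublyPeriodic

lemma pd1 {f : ℝ × ℝ → ℝ} (hf : DoublyPeriodic f) : DoublyPeriodic (pd1 f) :=
  ⟨fun x => by unfold _root_.pd1; rw [fderiv_add_period (c := 0) (by simpa using hf.1)],
   fun x => by unfold _root_.pd1; rw [fderiv_add_period (c := 0) (by simpa using hf.2)]⟩

lemma pd2 {f : ℝ × ℝ → ℝ} (hf : DoublyPeriodic f) : DoublyPeriodic (pd2 f) :=
  ⟨fun x => by unfold _root_.pd2; rw [fderiv_add_period (c := 0) (by simpa using hf.1)],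
   fun x => by unfold _root_.pd2; rw [fderiv_add_period (c := 0) (by simpa using hf.2)]⟩

lemma eq_zero {f : ℝ × ℝ → ℝ} (hf : DoublyPeriodic f) (h : ∀ x ∈ unitSquare, f x = 0)
    (x : ℝ × ℝ) : f x = 0 := by
  have h1 (t : ℝ) : Function.Periodic (fun s => f (s, t)) 1 := fun s => by
    simpa using hf.1 (s, t)
  have h2 (s : ℝ) : Function.Periodic (fun t => f (s, t)) 1 := fun t => by
    simpa using hf.2 (s, t)
  have e1 : f (Int.fract x.1, x.2) = f (x.1, x.2) := by
    simpa only [Int.self_sub_floor, mul_one] using (h1 x.2).sub_int_mul_eq ⌊x.1⌋ (x := x.1)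
  have e2 : f (Int.fract x.1, Int.fract x.2) = f (Int.fract x.1, x.2) := by
    simpa only [Int.self_sub_floor, mul_one] using
      (h2 (Int.fract x.1)).sub_int_mul_eq ⌊x.2⌋ (x := x.2)
  rw [← Prod.mk.eta (p := x), ← e1, ← e2]
  exact h _ ⟨⟨Int.fract_nonneg _, Int.fract_nonneg _⟩,
    ⟨(Int.fract_lt_one _).le, (Int.fract_lt_one _).le⟩⟩

lemma eq_zero_of_integral_nonpos {f : ℝ × ℝ → ℝ} (hf : DoublyPeriodic f) (hc : Continuous f)
    (hn : ∀ x, 0 ≤ f x) (hi : ∫ x in unitSquare, f x ≤ 0) (x : ℝ × ℝ) : f x = 0 := by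
  refine hf.eq_zero ?_ x
  have hint : IntegrableOn f unitSquare := hc.continuousOn.integrableOn_compact isCompact_Icc
  have h0 : f =ᵐ[volume.restrict unitSquare] 0 :=
    (integral_eq_zero_iff_of_nonneg hn hint).1 (hi.antisymm (integral_nonneg hn))
  refine Measure.eqOn_of_ae_eq h0 hc.continuousOn continuousOn_const ?_
  rw [unitSquare, ← Set.Icc_prod_Icc, interior_prod_eq, closure_prod_eq,
    interior_Icc, closure_Ioo zero_ne_one,
    Set.Icc_prod_Icc]

end DoublyPeriodic

lemma integral_divergence_unitSquare {f g : ℝ × ℝ → ℝ} (hf : ContDiff ℝ (⊤ : ℕ∞) f)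
    (hg : ContDiff ℝ (⊤ : ℕ∞) g) {c : ℝ} (pf : ∀ x, f (x + (1, 0)) = f x)
    (pg : ∀ x, g (x + (0, 1)) = g x + c) :
    ∫ x in unitSquare, (pd1 f x + pd2 g x) = c := by
  have hi : IntegrableOn (fun x => pd1 f x + pd2 g x) unitSquare :=
    ((pd1_contDiff hf).continuous.add
      (pd2_contDiff hg).continuous).continuousOn.integrableOn_compact isCompact_Icc
  have key := integral_divergence_prod_Icc_of_hasFDerivAt_of_le f g (fderiv ℝ f) (fderiv ℝ g)
    (0, 0) (1, 1) (by simp) hf.continuous.continuousOn hg.continuous.continuousOn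
    (fun x _ => (hf.differentiable (by simp) x).hasFDerivAt)
    (fun x _ => (hg.differentiable (by simp) x).hasFDerivAt) hi
  have e1 (y : ℝ) : f (1, y) = f (0, y) := by simpa using pf (0, y)
  have e2 (y : ℝ) : g (y, 1) = g (y, 0) + c := by simpa using pg (y, 0)
  have hgi : IntervalIntegrable (fun y => g (y, 0)) volume 0 1 :=
    (hg.continuous.comp (by fun_prop)).intervalIntegrable _ _
  simp only [e1, e2] at key
  rw [intervalIntegral.integral_add hgi (by simp)] at key
  simpa [pd1, pd2, unitSquare] using key

/-- A maximum principle on the torus for `Δz ≥ zu` with `u ≥ 0`. -/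
lemma maximum_principle {z u : ℝ × ℝ → ℝ} (hz : ContDiff ℝ (⊤ : ℕ∞) z) (pz : DoublyPeriodic z)
    (hn : ∀ x, 0 ≤ u x)
    (hΔ : ∀ x, 0 < z x → z x * u x ≤ pd1 (pd1 z) x + pd2 (pd2 z) x) :
    (∀ x, z x ≤ 0) ∨ ∀ x, u x = 0 := by
  by_contra! hcon
  obtain ⟨⟨x₀, hx₀⟩, ⟨y₀, hy₀⟩⟩ := hcon
  set θ := Real.smoothTransition
  have hθ : ContDiff ℝ (⊤ : ℕ∞) θ := Real.smoothTransition.contDiff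
  have hθd : Differentiable ℝ θ := hθ.differentiable (by simp)
  have hθ' (t : ℝ) : 0 ≤ deriv θ t := Real.smoothTransition.monotone.deriv_nonneg
  have hθc : Continuous (deriv θ) := hθ.continuous_deriv (by simp)
  have hz1 := pd1_contDiff hz
  have hz2 := pd2_contDiff hz
  have hzd : Differentiable ℝ z := hz.differentiable (by simp)
  have hfd (x : ℝ × ℝ) : HasFDerivAt (fun y => θ (z y)) (deriv θ (z x) • fderiv ℝ z x) x :=
    (hθd (z x)).hasDerivAt.comp_hasFDerivAt x (hzd x).hasFDerivAt
  have hmul {w : ℝ × ℝ → ℝ} (hw : ContDiff ℝ (⊤ : ℕ∞) w) (x : ℝ × ℝ) :=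
    ((hfd x).mul (hw.differentiable (by simp) x).hasFDerivAt).fderiv
  set R : ℝ × ℝ → ℝ := fun x => θ (z x) * (pd1 (pd1 z) x + pd2 (pd2 z) x)
    + deriv θ (z x) * (pd1 z x ^ 2 + pd2 z x ^ 2) with hR
  have hθz : ContDiff ℝ (⊤ : ℕ∞) (fun y => θ (z y)) := hθ.comp hz
  have hint : ∫ x in unitSquare, R x = 0 := by
    rw [← integral_divergence_unitSquare (hθz.mul hz1) (hθz.mul hz2) (c := 0)
      (fun x => by simp only [pz.1 x, pz.pd1.1 x])
      (fun x => by simp only [pz.2 x, pz.pd2.2 x, add_zero])]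
    congr 1
    ext x
    have e1 := congrArg (fun L => L (1, 0)) (hmul hz1 x)
    have e2 := congrArg (fun L => L (0, 1)) (hmul hz2 x)
    simp only [pd1, pd2, hR] at e1 e2 ⊢
    erw [e1, e2]
    simp
    ring
  have hnn (x : ℝ × ℝ) : 0 ≤ θ (z x) * (pd1 (pd1 z) x + pd2 (pd2 z) x) := by
    rcases le_or_gt (z x) 0 with h | h
    · simp [θ, Real.smoothTransition.zero_of_nonpos h]
    · exact mul_nonneg (Real.smoothTransition.nonneg _)
        ((mul_nonneg h.le (hn x)).trans (hΔ x h))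
  have hnn' (x : ℝ × ℝ) : 0 ≤ deriv θ (z x) * (pd1 z x ^ 2 + pd2 z x ^ 2) :=
    mul_nonneg (hθ' _) (by positivity)
  have hR0 : ∀ x, R x = 0 := by
    refine DoublyPeriodic.eq_zero_of_integral_nonpos ⟨fun x => ?_, fun x => ?_⟩ ?_
      (fun x => add_nonneg (hnn x) (hnn' x)) hint.le
    · simp only [hR, pz.1 x, pz.pd1.1 x, pz.pd2.1 x, pz.pd1.pd1.1 x, pz.pd2.pd2.1 x]
    · simp only [hR, pz.2 x, pz.pd1.2 x, pz.pd2.2 x, pz.pd1.pd1.2 x, pz.pd2.pd2.2 x]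
    · have c1 := hz1.continuous
      have c2 := hz2.continuous
      have c3 := (pd1_contDiff hz1).continuous
      have c4 := (pd2_contDiff hz2).continuous
      have c5 := hθz.continuous
      have c6 := hz.continuous
      fun_prop
  have hconst (x y : ℝ × ℝ) : θ (z x) = θ (z y) := by
    refine is_const_of_fderiv_eq_zero (𝕜 := ℝ) (fun x => (hfd x).differentiableAt) (fun x => ?_) x y
    rw [(hfd x).fderiv]
    have h0 : deriv θ (z x) * (pd1 z x ^ 2 + pd2 z x ^ 2) = 0 :=
      le_antisymm (by linarith [hR0 x, hnn x]) (hnn' x)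
    rcases mul_eq_zero.1 h0 with h | h
    · simp [h]
    · have h1 : pd1 z x = 0 := by nlinarith [sq_nonneg (pd1 z x), sq_nonneg (pd2 z x)]
      have h2 : pd2 z x = 0 := by nlinarith [sq_nonneg (pd1 z x), sq_nonneg (pd2 z x)]
      have : fderiv ℝ z x = 0 := by
        ext
        · simpa [pd1] using h1
        · simpa [pd2] using h2
      simp [this]
  have hpos (x : ℝ × ℝ) : 0 < z x := by
    by_contra! h
    have := Real.smoothTransition.pos_of_pos hx₀
    rw [show Real.smoothTransition (z x₀) = Real.smoothTransition (z x) from hconst x₀ x,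
      Real.smoothTransition.zero_of_nonpos h] at this
    exact this.false
  have h0 : θ (z y₀) * (pd1 (pd1 z) y₀ + pd2 (pd2 z) y₀) = 0 :=
    le_antisymm (by linarith [hR0 y₀, hnn' y₀]) (hnn y₀)
  have hu0 : 0 < u y₀ := (hn y₀).lt_of_ne' hy₀
  have := mul_pos (Real.smoothTransition.pos_of_pos (hpos y₀))
    ((mul_pos (hpos y₀) hu0).trans_le (hΔ y₀ (hpos y₀)))
  exact this.ne' h0

section CovariantDerivatives

variable {f g φ : ℝ × ℝ → ℂ} {a a1 a2 : ℝ × ℝ → ℝ}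

lemma D1_contDiff (ha : ContDiff ℝ (⊤ : ℕ∞) a) (hf : ContDiff ℝ (⊤ : ℕ∞) f) :
    ContDiff ℝ (⊤ : ℕ∞) (D1 a f) :=
  (pd1_contDiff hf).add ((contDiff_const.mul (ofRealCLM.contDiff.comp ha)).mul hf)

lemma D2_contDiff (ha : ContDiff ℝ (⊤ : ℕ∞) a) (hf : ContDiff ℝ (⊤ : ℕ∞) f) :
    ContDiff ℝ (⊤ : ℕ∞) (D2 a f) :=
  (pd2_contDiff hf).add ((contDiff_const.mul (ofRealCLM.contDiff.comp ha)).mul hf)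

lemma hasFDerivAt_conj_mul (hf : Differentiable ℝ f) (hg : Differentiable ℝ g) (x : ℝ × ℝ) :
    HasFDerivAt (fun y => (starRingEnd ℂ) (f y) * g y)
      ((starRingEnd ℂ) (f x) • fderiv ℝ g x
        + g x • (conjCLE.toContinuousLinearMap.comp (fderiv ℝ f x))) x :=
  (conjCLE.hasFDerivAt.comp x (hf x).hasFDerivAt).mul (hg x).hasFDerivAt

lemma fderiv_conj_mul_re (hf : Differentiable ℝ f) (hg : Differentiable ℝ g) (x v : ℝ × ℝ) :
    fderiv ℝ (fun y => ((starRingEnd ℂ) (f y) * g y).re) x v =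
      ((starRingEnd ℂ) (f x) * fderiv ℝ g x v + (starRingEnd ℂ) (fderiv ℝ f x v) * g x).re := by
  have h := reCLM.hasFDerivAt.comp x (hasFDerivAt_conj_mul hf hg x)
  have e := congrArg (fun L => L v) h.fderiv
  refine e.trans ?_
  simp [mul_comm]

lemma fderiv_conj_mul_im (hf : Differentiable ℝ f) (hg : Differentiable ℝ g) (x v : ℝ × ℝ) :
    fderiv ℝ (fun y => ((starRingEnd ℂ) (f y) * g y).im) x v =
      ((starRingEnd ℂ) (f x) * fderiv ℝ g x v + (starRingEnd ℂ) (fderiv ℝ f x v) * g x).im := by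
  have h := imCLM.hasFDerivAt.comp x (hasFDerivAt_conj_mul hf hg x)
  have e := congrArg (fun L => L v) h.fderiv
  refine e.trans ?_
  simp
  ring

lemma pd1_conj_mul_re (a : ℝ × ℝ → ℝ) (hf : Differentiable ℝ f) (hg : Differentiable ℝ g)
    (x : ℝ × ℝ) : pd1 (fun y => ((starRingEnd ℂ) (f y) * g y).re) x =
      ((starRingEnd ℂ) (f x) * D1 a g x + (starRingEnd ℂ) (D1 a f x) * g x).re := by
  rw [pd1, fderiv_conj_mul_re hf hg]
  simp [D1, pd1]
  ring

lemma pd2_conj_mul_re (a : ℝ × ℝ → ℝ) (hf : Differentiable ℝ f) (hg : Differentiable ℝ g)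
    (x : ℝ × ℝ) : pd2 (fun y => ((starRingEnd ℂ) (f y) * g y).re) x =
      ((starRingEnd ℂ) (f x) * D2 a g x + (starRingEnd ℂ) (D2 a f x) * g x).re := by
  rw [pd2, fderiv_conj_mul_re hf hg]
  simp [D2, pd2]
  ring

lemma pd1_conj_mul_im (a : ℝ × ℝ → ℝ) (hf : Differentiable ℝ f) (hg : Differentiable ℝ g)
    (x : ℝ × ℝ) : pd1 (fun y => ((starRingEnd ℂ) (f y) * g y).im) x =
      ((starRingEnd ℂ) (f x) * D1 a g x + (starRingEnd ℂ) (D1 a f x) * g x).im := by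
  rw [pd1, fderiv_conj_mul_im hf hg]
  simp [D1, pd1]
  ring

lemma pd2_conj_mul_im (a : ℝ × ℝ → ℝ) (hf : Differentiable ℝ f) (hg : Differentiable ℝ g)
    (x : ℝ × ℝ) : pd2 (fun y => ((starRingEnd ℂ) (f y) * g y).im) x =
      ((starRingEnd ℂ) (f x) * D2 a g x + (starRingEnd ℂ) (D2 a f x) * g x).im := by
  rw [pd2, fderiv_conj_mul_im hf hg]
  simp [D2, pd2]
  ring

lemma fderiv_covariant (hg : Differentiable ℝ g) (ha : Differentiable ℝ a)
    (hf : Differentiable ℝ f) (x v : ℝ × ℝ) :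
    fderiv ℝ (fun y => g y + I * (a y : ℂ) * f y) x v =
      fderiv ℝ g x v + I * ((fderiv ℝ a x v : ℝ) : ℂ) * f x + I * (a x : ℂ) * fderiv ℝ f x v := by
  have h := (hg x).hasFDerivAt.add
    (((ofRealCLM.hasFDerivAt.comp x (ha x).hasFDerivAt).const_mul I).mul (hf x).hasFDerivAt)
  have e := congrArg (fun L => L v) h.fderiv
  refine e.trans ?_
  simp
  ring

lemma D1_D2_commutator (h1 : ContDiff ℝ (⊤ : ℕ∞) a1) (h2 : ContDiff ℝ (⊤ : ℕ∞) a2)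
    (hφ : ContDiff ℝ (⊤ : ℕ∞) φ) (x : ℝ × ℝ) :
    D1 a1 (D2 a2 φ) x - D2 a2 (D1 a1 φ) x = I * (curv a1 a2 x : ℂ) * φ x := by
  have hd := hφ.differentiable (by simp)
  have e1 := fderiv_covariant ((pd2_contDiff hφ).differentiable (by simp))
    (h2.differentiable (by simp)) hd x (1, 0)
  have e2 := fderiv_covariant ((pd1_contDiff hφ).differentiable (by simp))
    (h1.differentiable (by simp)) hd x (0, 1)
  have e3 : pd1 (D2 a2 φ) x = _ := e1
  have e4 : pd2 (D1 a1 φ) x = _ := e2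
  have hs : fderiv ℝ (pd2 φ) x (1, 0) = fderiv ℝ (pd1 φ) x (0, 1) := pd1_pd2_comm hφ x
  rw [show D1 a1 (D2 a2 φ) x = pd1 (D2 a2 φ) x + I * (a1 x : ℂ) * D2 a2 φ x from rfl,
    show D2 a2 (D1 a1 φ) x = pd2 (D1 a1 φ) x + I * (a2 x : ℂ) * D1 a1 φ x from rfl, e3, e4, hs]
  simp only [D1, D2, curv, pd1, pd2]
  push_cast
  ring

lemma normSq_eq_conj_mul_re (z : ℂ) : normSq z = ((starRingEnd ℂ) z * z).re := by
  rw [← normSq_eq_conj_mul_self, ofReal_re]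

lemma laplacian_normSq (h1 : ContDiff ℝ (⊤ : ℕ∞) a1) (h2 : ContDiff ℝ (⊤ : ℕ∞) a2)
    (hφ : ContDiff ℝ (⊤ : ℕ∞) φ) (x : ℝ × ℝ) :
    pd1 (pd1 fun y => normSq (φ y)) x + pd2 (pd2 fun y => normSq (φ y)) x =
      2 * (normSq (D1 a1 φ x) + normSq (D2 a2 φ x)
        + ((starRingEnd ℂ) (φ x) * (D1 a1 (D1 a1 φ) x + D2 a2 (D2 a2 φ) x)).re) := by
  have hd := hφ.differentiable (by simp)
  have hd1 := (D1_contDiff h1 hφ).differentiable (by simp)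
  have hd2 := (D2_contDiff h2 hφ).differentiable (by simp)
  have e1 : pd1 (fun y => normSq (φ y)) =
      fun y => 2 * ((starRingEnd ℂ) (φ y) * D1 a1 φ y).re := by
    ext y
    simp only [normSq_eq_conj_mul_re]
    rw [pd1_conj_mul_re a1 hd hd]
    simp
    ring
  have e2 : pd2 (fun y => normSq (φ y)) =
      fun y => 2 * ((starRingEnd ℂ) (φ y) * D2 a2 φ y).re := by
    ext y
    simp only [normSq_eq_conj_mul_re]
    rw [pd2_conj_mul_re a2 hd hd]
    simp
    ring
  have e3 : pd1 (fun y => 2 * ((starRingEnd ℂ) (φ y) * D1 a1 φ y).re) x =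
      2 * pd1 (fun y => ((starRingEnd ℂ) (φ y) * D1 a1 φ y).re) x := by
    unfold pd1
    rw [fderiv_const_mul]
    · rfl
    · exact (reCLM.hasFDerivAt.comp x (hasFDerivAt_conj_mul hd hd1 x)).differentiableAt
  have e4 : pd2 (fun y => 2 * ((starRingEnd ℂ) (φ y) * D2 a2 φ y).re) x =
      2 * pd2 (fun y => ((starRingEnd ℂ) (φ y) * D2 a2 φ y).re) x := by
    unfold pd2
    rw [fderiv_const_mul]
    · rfl
    · exact (reCLM.hasFDerivAt.comp x (hasFDerivAt_conj_mul hd hd2 x)).differentiableAt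
  rw [e1, e2, e3, e4, pd1_conj_mul_re a1 hd hd1, pd2_conj_mul_re a2 hd hd2]
  simp [normSq_apply]
  ring

end CovariantDerivatives

section GinzburgLandau

variable {α β : ℝ} {F₀ : ℝ × ℝ → ℝ} {d : ℤ} {P : FieldPair d}

lemma curv_contDiff (P : FieldPair d) : ContDiff ℝ (⊤ : ℕ∞) (curv P.a1 P.a2) :=
  (pd1_contDiff P.smooth_a2).sub (pd2_contDiff P.smooth_a1)

lemma normSq_contDiff (P : FieldPair d) : ContDiff ℝ (⊤ : ℕ∞) fun y => normSq (P.φ y) := by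
  simp only [normSq_apply]
  have h1 : ContDiff ℝ (⊤ : ℕ∞) fun y => (P.φ y).re := reCLM.contDiff.comp P.smooth_φ
  have h2 : ContDiff ℝ (⊤ : ℕ∞) fun y => (P.φ y).im := imCLM.contDiff.comp P.smooth_φ
  exact (h1.mul h1).add (h2.mul h2)

lemma curv_doublyPeriodic (P : FieldPair d) : DoublyPeriodic (curv P.a1 P.a2) := by
  have h1 (x : ℝ × ℝ) : fderiv ℝ P.a1 (x + (1, 0)) = fderiv ℝ P.a1 x :=
    fderiv_add_period (c := 0) (fun y => by simpa [Prod.add_def] using P.per1_a1 y) x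
  have h2 (x : ℝ × ℝ) : fderiv ℝ P.a2 (x + (1, 0)) = fderiv ℝ P.a2 x :=
    fderiv_add_period (c := 0) (fun y => by simpa [Prod.add_def] using P.per1_a2 y) x
  have h3 (x : ℝ × ℝ) : fderiv ℝ P.a1 (x + (0, 1)) = fderiv ℝ P.a1 x :=
    fderiv_add_period (c := -(2 * Real.pi * d))
      (fun y => by simpa [Prod.add_def, sub_eq_add_neg] using P.per2_a1 y) x
  have h4 (x : ℝ × ℝ) : fderiv ℝ P.a2 (x + (0, 1)) = fderiv ℝ P.a2 x :=
    fderiv_add_period (c := 0) (fun y => by simpa [Prod.add_def] using P.per2_a2 y) x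
  exact ⟨fun x => by simp only [curv, pd1, pd2, h1, h2],
    fun x => by simp only [curv, pd1, pd2, h3, h4]⟩

lemma normSq_doublyPeriodic (P : FieldPair d) : DoublyPeriodic fun y => normSq (P.φ y) := by
  refine ⟨fun x => ?_, fun x => ?_⟩
  · have := P.per1_φ x
    simp [Prod.add_def, this]
  · have h := P.per2_φ x
    have hn : ‖exp (2 * Real.pi * I * (d : ℂ) * (x.1 : ℂ))‖ = 1 := by
      rw [show (2 * Real.pi * I * (d : ℂ) * (x.1 : ℂ)) = ((2 * Real.pi * d * x.1 : ℝ) : ℂ) * I by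
        push_cast; ring]
      exact norm_exp_ofReal_mul_I _
    simp [Prod.add_def, h, normSq_eq_norm_sq, hn]

/-- The flux of the curvature is the degree. -/
lemma integral_curv (P : FieldPair d) : ∫ x in unitSquare, curv P.a1 P.a2 x = 2 * Real.pi * d := by
  rw [← integral_divergence_unitSquare P.smooth_a2 P.smooth_a1.neg (c := 2 * Real.pi * d)
    (fun x => by simpa [Prod.add_def] using P.per1_a2 x)
    (fun x => by
      have := P.per2_a1 x
      simp only [Prod.add_def, add_zero]
      rw [this]
      ring)]
  congr 1
  ext x
  simp [curv, pd1, pd2, sub_eq_add_neg, fderiv_fun_neg]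

lemma laplacian_normSq_of_isGLSolution (hP : IsGLSolution α β F₀ P) (x : ℝ × ℝ) :
    pd1 (pd1 fun y => normSq (P.φ y)) x + pd2 (pd2 fun y => normSq (P.φ y)) x =
      2 * (normSq (D1 P.a1 P.φ x) + normSq (D2 P.a2 P.φ x)
        + (β * normSq (P.φ x) - α) * normSq (P.φ x)) := by
  rw [laplacian_normSq P.smooth_a1 P.smooth_a2 P.smooth_φ, ← neg_neg (D1 _ (D1 _ _) _ + _),
    hP.2.2 x, ← ofReal_pow, ← normSq_eq_norm_sq]
  simp [normSq_apply]
  ring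

lemma laplacian_curv_of_isGLSolution (hP : IsGLSolution α β F₀ P) {c : ℝ} (hc : ∀ x, F₀ x = c)
    (x : ℝ × ℝ) :
    pd1 (pd1 (curv P.a1 P.a2)) x + pd2 (pd2 (curv P.a1 P.a2)) x =
      2 * ((starRingEnd ℂ) (D1 P.a1 P.φ x) * D2 P.a2 P.φ x).im
        + curv P.a1 P.a2 x * normSq (P.φ x) := by
  have hd := P.smooth_φ.differentiable (by simp)
  have hd1 := (D1_contDiff P.smooth_a1 P.smooth_φ).differentiable (by simp)
  have hd2 := (D2_contDiff P.smooth_a2 P.smooth_φ).differentiable (by simp)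
  have e1 : pd1 (curv P.a1 P.a2) = fun y => ((starRingEnd ℂ) (P.φ y) * D2 P.a2 P.φ y).im := by
    ext y
    have := hP.2.1 y
    simp only [hc, pd1, fderiv_sub_const] at this ⊢
    linarith
  have e2 : pd2 (curv P.a1 P.a2) =
      fun y => (-1 : ℝ) * ((starRingEnd ℂ) (P.φ y) * D1 P.a1 P.φ y).im := by
    ext y
    have := hP.1 y
    simp only [hc, pd2, fderiv_sub_const] at this ⊢
    linarith
  have e3 : pd2 (fun y => (-1 : ℝ) * ((starRingEnd ℂ) (P.φ y) * D1 P.a1 P.φ y).im) x =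
      (-1 : ℝ) * pd2 (fun y => ((starRingEnd ℂ) (P.φ y) * D1 P.a1 P.φ y).im) x := by
    unfold pd2
    rw [fderiv_const_mul]
    · rfl
    · exact (imCLM.hasFDerivAt.comp x (hasFDerivAt_conj_mul hd hd1 x)).differentiableAt
  rw [e1, e2, e3, pd1_conj_mul_im P.a1 hd hd2, pd2_conj_mul_im P.a2 hd hd1,
    eq_add_of_sub_eq (D1_D2_commutator P.smooth_a1 P.smooth_a2 P.smooth_φ x)]
  simp [normSq_apply]
  ring

lemma fderiv_fderiv_linear_combination {f g : ℝ × ℝ → ℝ} (hf : ContDiff ℝ (⊤ : ℕ∞) f)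
    (hg : ContDiff ℝ (⊤ : ℕ∞) g) (r s t : ℝ) (x v : ℝ × ℝ) :
    fderiv ℝ (fun y => fderiv ℝ (fun z => r * f z + s * g z - t) y v) x v =
      r * fderiv ℝ (fun y => fderiv ℝ f y v) x v + s * fderiv ℝ (fun y => fderiv ℝ g y v) x v := by
  have key {f g : ℝ × ℝ → ℝ} (hf : ContDiff ℝ (⊤ : ℕ∞) f) (hg : ContDiff ℝ (⊤ : ℕ∞) g) (t : ℝ)
      (y : ℝ × ℝ) : fderiv ℝ (fun z => r * f z + s * g z - t) y v =
        r * fderiv ℝ f y v + s * fderiv ℝ g y v - 0 := by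
    have h := (((hf.differentiable (by simp) y).hasFDerivAt.const_mul r).add
      ((hg.differentiable (by simp) y).hasFDerivAt.const_mul s)).sub_const t
    refine (congrArg (fun L => L v) h.fderiv).trans ?_
    simp
  rw [funext (key hf hg t), key _ _ 0 x, sub_zero]
  · exact (hf.fderiv_right (by norm_cast)).clm_apply contDiff_const
  · exact (hg.fderiv_right (by norm_cast)).clm_apply contDiff_const

lemma laplacian_linear_combination {f g : ℝ × ℝ → ℝ} (hf : ContDiff ℝ (⊤ : ℕ∞) f)
    (hg : ContDiff ℝ (⊤ : ℕ∞) g) (r s t : ℝ) (x : ℝ × ℝ) :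
    pd1 (pd1 fun z => r * f z + s * g z - t) x + pd2 (pd2 fun z => r * f z + s * g z - t) x =
      r * (pd1 (pd1 f) x + pd2 (pd2 f) x) + s * (pd1 (pd1 g) x + pd2 (pd2 g) x) := by
  have e1 := fderiv_fderiv_linear_combination hf hg r s t x (1, 0)
  have e2 := fderiv_fderiv_linear_combination hf hg r s t x (0, 1)
  unfold pd1 pd2
  rw [e1, e2]
  ring

lemma two_mul_im_conj_mul_le {σ : ℝ} (hσ : σ ^ 2 = 1) (z w : ℂ) :
    0 ≤ normSq z + normSq w + σ * (2 * ((starRingEnd ℂ) z * w).im) := by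
  have : normSq z + normSq w + σ * (2 * ((starRingEnd ℂ) z * w).im) =
      (z.re + σ * w.im) ^ 2 + (z.im - σ * w.re) ^ 2 := by
    simp [normSq_apply]
    linear_combination (-(w.im ^ 2) - w.re ^ 2) * hσ
  rw [this]
  positivity

/-- The pointwise bound `|φ|² ≤ α / β` for solutions of the Ginzburg–Landau equations. -/
lemma mul_normSq_le_of_isGLSolution (hα : 0 < α) (hβ : 0 < β) (hP : IsGLSolution α β F₀ P)
    (x : ℝ × ℝ) : β * normSq (P.φ x) ≤ α := by
  have hu := normSq_contDiff P
  have pu := normSq_doublyPeriodic P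
  have hΔ (y : ℝ × ℝ) : (0 * normSq (P.φ y) + β * normSq (P.φ y) - α) * (2 * β * normSq (P.φ y)) ≤
      pd1 (pd1 fun y => 0 * normSq (P.φ y) + β * normSq (P.φ y) - α) y
        + pd2 (pd2 fun y => 0 * normSq (P.φ y) + β * normSq (P.φ y) - α) y := by
    rw [laplacian_linear_combination hu hu, laplacian_normSq_of_isGLSolution hP]
    have h1 := mul_nonneg hβ.le (normSq_nonneg (D1 P.a1 P.φ y))
    have h2 := mul_nonneg hβ.le (normSq_nonneg (D2 P.a2 P.φ y))
    linarith
  rcases maximum_principle (z := fun y => 0 * normSq (P.φ y) + β * normSq (P.φ y) - α)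
    (u := fun y => 2 * β * normSq (P.φ y))
    (((contDiff_const.mul hu).add (contDiff_const.mul hu)).sub contDiff_const)
    ⟨fun y => by simp only [pu.1 y], fun y => by simp only [pu.2 y]⟩
    (fun y => by have := normSq_nonneg (P.φ y); positivity) (fun y _ => hΔ y) with h | h
  · linarith [h x]
  · have : normSq (P.φ x) = 0 := by simpa [hβ.ne'] using h x
    simpa [this] using hα.le

end GinzburgLandau

/-- if `F₀` is constant and `max{α, α/(2β)} ≤ 2π|d|`, then every
degree-`d` GL solution is reducible. -/
theorem statement4 (α β : ℝ) (hα : 0 < α) (hβ : 0 < β) (d : ℤ) (F₀ : ℝ × ℝ → ℝ)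
    (hF₀ : ExternalField d F₀) (hconst : ∃ c : ℝ, ∀ x : ℝ × ℝ, F₀ x = c)
    (hle : max α (α / (2 * β)) ≤ 2 * Real.pi * |(d : ℝ)|) :
    ∀ P : FieldPair d, IsGLSolution α β F₀ P → ∀ x : ℝ × ℝ, P.φ x = 0 := by
  intro P hP x
  obtain ⟨c, hc⟩ := hconst
  obtain ⟨σ, hσ, hσd⟩ : ∃ σ : ℝ, σ ^ 2 = 1 ∧ σ * d = |(d : ℝ)| := by
    rcases abs_cases (d : ℝ) with ⟨h, _⟩ | ⟨h, _⟩
    · exact ⟨1, by norm_num, by rw [h]; ring⟩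
    · exact ⟨-1, by norm_num, by rw [h]; ring⟩
  set K := 2 * Real.pi * |(d : ℝ)|
  have hKα : α ≤ K := (le_max_left _ _).trans hle
  have hKβ : α ≤ K * (2 * β) := (div_le_iff₀ (by positivity)).1 ((le_max_right _ _).trans hle)
  have hu := normSq_contDiff P
  have pu := normSq_doublyPeriodic P
  have hF := curv_contDiff P
  have pF := curv_doublyPeriodic P
  have hn (y : ℝ × ℝ) := normSq_nonneg (P.φ y)
  suffices h : ∀ y, normSq (P.φ y) = 0 from normSq_eq_zero.1 (h x)
  have hΔ (y : ℝ × ℝ) :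
      (σ * curv P.a1 P.a2 y + 1 / 2 * normSq (P.φ y) - K) * normSq (P.φ y) ≤
      pd1 (pd1 fun y => σ * curv P.a1 P.a2 y + 1 / 2 * normSq (P.φ y) - K) y
        + pd2 (pd2 fun y => σ * curv P.a1 P.a2 y + 1 / 2 * normSq (P.φ y) - K) y := by
    rw [laplacian_linear_combination hF hu, laplacian_normSq_of_isGLSolution hP,
      laplacian_curv_of_isGLSolution hP hc]
    have h1 := two_mul_im_conj_mul_le hσ (D1 P.a1 P.φ y) (D2 P.a2 P.φ y)
    have h2 : 0 ≤ K - α + (β - 1 / 2) * normSq (P.φ y) := by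
      have h3 := mul_normSq_le_of_isGLSolution hα hβ hP y
      rcases le_total (1 / 2) β with hb | hb
      · nlinarith [hn y]
      · have h4 : 0 ≤ β * (K - α + (β - 1 / 2) * normSq (P.φ y)) := by nlinarith
        exact nonneg_of_mul_nonneg_right h4 hβ
    nlinarith [mul_nonneg h2 (hn y)]
  rcases maximum_principle (z := fun y => σ * curv P.a1 P.a2 y + 1 / 2 * normSq (P.φ y) - K)
    (((contDiff_const.mul hF).add (contDiff_const.mul hu)).sub contDiff_const)
    ⟨fun y => by simp only [pu.1 y, pF.1 y], fun y => by simp only [pu.2 y, pF.2 y]⟩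
    hn (fun y _ => hΔ y) with h | h
  · refine pu.eq_zero_of_integral_nonpos hu.continuous hn ?_
    have hFi : IntegrableOn (curv P.a1 P.a2) unitSquare :=
      hF.continuous.continuousOn.integrableOn_compact isCompact_Icc
    have hui : IntegrableOn (fun y => normSq (P.φ y)) unitSquare :=
      hu.continuous.continuousOn.integrableOn_compact isCompact_Icc
    have hKi : IntegrableOn (fun _ : ℝ × ℝ => K) unitSquare :=
      continuousOn_const.integrableOn_compact isCompact_Icc
    have hvol : volume.real unitSquare = 1 := by
      rw [unitSquare, ← Set.Icc_prod_Icc, Measure.volume_eq_prod, measureReal_prod_prod]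
      simp
    calc ∫ y in unitSquare, normSq (P.φ y)
        ≤ ∫ y in unitSquare, 2 * (K - σ * curv P.a1 P.a2 y) :=
          integral_mono hui ((hKi.sub (hFi.const_mul σ)).const_mul 2)
            (fun y => by have := h y; simp only at this ⊢; linarith)
      _ = 2 * (K - σ * (2 * Real.pi * d)) := by
          rw [integral_const_mul, integral_sub hKi (hFi.const_mul σ),
            integral_const_mul σ, integral_curv, setIntegral_const, hvol, one_smul]
      _ = 0 := by linear_combination (-4 * Real.pi) * hσd
      _ ≤ 0 := le_rfl
  · exact h
end
end

section
/- Every degree-d GL solution (a,φ) satisfies the pointwise bound |φ(x)| ≤ √(α/β) for all x ∈ ℝ². -/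
open MeasureTheory Complex

noncomputable section

/-- Necessary second-order condition at a local maximum of a function of one real variable. -/
theorem IsLocalMax.second_deriv_nonpos {g g' : ℝ → ℝ} {c t : ℝ} (hmax : IsLocalMax g t)
    (hg : ∀ s, HasDerivAt g (g' s) s) (hg' : HasDerivAt g' c t) : c ≤ 0 := by
  have hd : deriv g = g' := funext fun s => (hg s).deriv
  by_contra! hc
  have hmin : IsLocalMin g t :=
    isLocalMin_of_deriv_deriv_pos (by rwa [hd, hg'.deriv]) hmax.deriv_eq_zero (hg t).continuousAt
  have hconst : g =ᶠ[nhds t] fun _ => g t := by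
    filter_upwards [hmax, hmin] with s h₁ h₂ using le_antisymm h₁ h₂
  have hzero := hconst.deriv.deriv_eq
  rw [hd, hg'.deriv] at hzero
  simp at hzero
  exact hc.ne' hzero

/-- Leibniz rule for the real part of the hermitian pairing along a curve, with respect to the
unitary covariant derivative `∂ + i a`. -/
theorem hasDerivAt_re_conj_mul {f p : ℝ → ℂ} {a t : ℝ} {v w : ℂ}
    (hf : HasDerivAt f (v - I * a * f t) t) (hp : HasDerivAt p (w - I * a * p t) t) :
    HasDerivAt (fun s => ((starRingEnd ℂ) (f s) * p s).re)
      ((starRingEnd ℂ) v * p t + (starRingEnd ℂ) (f t) * w).re t := by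
  have h := (reCLM.hasFDerivAt (x := star (f t) * p t)).comp_hasDerivAt t (hf.star.mul hp)
  refine h.congr_deriv ?_
  simp [Complex.add_re, Complex.mul_re]
  ring

/-- If the norm of a section along a curve has a local maximum, then `|Df|² + Re ⟨f, DDf⟩ ≤ 0`
there. -/
theorem IsLocalMax.covariant_second_deriv_nonpos {f p : ℝ → ℂ} {a : ℝ → ℝ} {t : ℝ} {q : ℂ}
    (hmax : IsLocalMax (fun s => ‖f s‖) t)
    (hf : ∀ s, HasDerivAt f (p s - I * a s * f s) s)
    (hp : HasDerivAt p (q - I * a t * p t) t) :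
    ‖p t‖ ^ 2 + ((starRingEnd ℂ) (f t) * q).re ≤ 0 := by
  have hsq : IsLocalMax (fun s => ((starRingEnd ℂ) (f s) * f s).re) t := by
    filter_upwards [hmax] with s hs
    simp only [← normSq_eq_conj_mul_self, ofReal_re, normSq_eq_norm_sq]
    gcongr
  have hg : ∀ s, HasDerivAt (fun s => ((starRingEnd ℂ) (f s) * f s).re)
      (2 * ((starRingEnd ℂ) (f s) * p s).re) s := fun s => by
    refine (hasDerivAt_re_conj_mul (hf s) (hf s)).congr_deriv ?_
    simp [Complex.mul_re]
    ring
  have h := hsq.second_deriv_nonpos hg ((hasDerivAt_re_conj_mul (hf t) hp).const_mul 2)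
  rw [Complex.add_re, ← normSq_eq_conj_mul_self, ofReal_re, normSq_eq_norm_sq] at h
  linarith

/-- A continuous function on the plane which is 1-periodic in each variable attains its maximum. -/
theorem exists_forall_le_of_periodic {f : ℝ × ℝ → ℝ} (hf : Continuous f)
    (h₁ : ∀ x : ℝ × ℝ, f (x.1 + 1, x.2) = f x) (h₂ : ∀ x : ℝ × ℝ, f (x.1, x.2 + 1) = f x) :
    ∃ x₀, ∀ x, f x ≤ f x₀ := by
  obtain ⟨x₀, -, hx₀⟩ := (isCompact_Icc (a := ((0, 0) : ℝ × ℝ)) (b := (1, 1))).exists_isMaxOn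
    ⟨(0, 0), by simp [Prod.le_def]⟩ hf.continuousOn
  refine ⟨x₀, fun x => ?_⟩
  have p₁ : Function.Periodic (fun s => f (s, x.2)) 1 := fun s => h₁ (s, x.2)
  obtain ⟨s, hs, hfs⟩ := p₁.exists_mem_Ico₀ one_pos x.1
  have p₂ : Function.Periodic (fun r => f (s, r)) 1 := fun r => h₂ (s, r)
  obtain ⟨r, hr, hfr⟩ := p₂.exists_mem_Ico₀ one_pos x.2
  calc f x = f (s, r) := hfs.trans hfr
    _ ≤ f x₀ := hx₀ ⟨⟨hs.1, hr.1⟩, ⟨hs.2.le, hr.2.le⟩⟩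

/-- every degree-`d` GL solution satisfies `|φ| ≤ √(α/β)` pointwise. -/
theorem statement6 (α β : ℝ) (hα : 0 < α) (hβ : 0 < β) (d : ℤ) (F₀ : ℝ × ℝ → ℝ)
    (hF₀ : ExternalField d F₀) (P : FieldPair d) (hP : IsGLSolution α β F₀ P) :
    ∀ x : ℝ × ℝ, ‖P.φ x‖ ≤ Real.sqrt (α / β) := by
  obtain ⟨x₀, hx₀⟩ := exists_forall_le_of_periodic (f := fun x => ‖P.φ x‖)
    P.smooth_φ.continuous.norm (fun x => by rw [P.per1_φ]) (fun x => by
      rw [P.per2_φ, norm_mul, show 2 * (Real.pi : ℂ) * I * (d : ℂ) * (x.1 : ℂ)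
        = ((2 * Real.pi * d * x.1 : ℝ) : ℂ) * I by push_cast; ring, norm_exp_ofReal_mul_I, one_mul])
  have hφ : Differentiable ℝ P.φ := P.smooth_φ.differentiable (by simp)
  have hfd (v : ℝ × ℝ) : Differentiable ℝ fun x => fderiv ℝ P.φ x v :=
    ((P.smooth_φ.fderiv_right (m := 1) (by norm_cast)).clm_apply contDiff_const).differentiable
      (by simp)
  have ha₁ : Differentiable ℝ P.a1 := P.smooth_a1.differentiable (by simp)
  have ha₂ : Differentiable ℝ P.a2 := P.smooth_a2.differentiable (by simp)
  have hofReal : Differentiable ℝ (fun r : ℝ => (r : ℂ)) := ofRealCLM.differentiable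
  have hD₁ : Differentiable ℝ (D1 P.a1 P.φ) :=
    (hfd (1, 0)).add (((hofReal.comp ha₁).const_mul I).mul hφ)
  have hD₂ : Differentiable ℝ (D2 P.a2 P.φ) :=
    (hfd (0, 1)).add (((hofReal.comp ha₂).const_mul I).mul hφ)
  have hline (v : ℝ × ℝ) (ψ : ℝ × ℝ → ℂ) (hψ : Differentiable ℝ ψ) (s : ℝ) :
      HasDerivAt (fun t : ℝ => ψ (x₀ + t • v)) (fderiv ℝ ψ (x₀ + s • v) v) s :=
    (hψ _).hasFDerivAt.comp_hasDerivAt s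
      (by simpa using ((hasDerivAt_id s).smul_const v).const_add x₀)
  have hmax (v : ℝ × ℝ) : IsLocalMax (fun t : ℝ => ‖P.φ (x₀ + t • v)‖) 0 :=
    Filter.Eventually.of_forall fun t => by simpa using hx₀ (x₀ + t • v)
  have e₁ := (hmax (1, 0)).covariant_second_deriv_nonpos
    (p := fun t => D1 P.a1 P.φ (x₀ + t • (1, 0))) (a := fun t => P.a1 (x₀ + t • (1, 0)))
    (q := D1 P.a1 (D1 P.a1 P.φ) (x₀ + (0 : ℝ) • (1, 0)))
    (fun s => (hline _ _ hφ s).congr_deriv (by simp [D1, pd1]))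
    ((hline _ _ hD₁ 0).congr_deriv (eq_sub_of_add_eq rfl))
  have e₂ := (hmax (0, 1)).covariant_second_deriv_nonpos
    (p := fun t => D2 P.a2 P.φ (x₀ + t • (0, 1))) (a := fun t => P.a2 (x₀ + t • (0, 1)))
    (q := D2 P.a2 (D2 P.a2 P.φ) (x₀ + (0 : ℝ) • (0, 1)))
    (fun s => (hline _ _ hφ s).congr_deriv (by simp [D2, pd2]))
    ((hline _ _ hD₂ 0).congr_deriv (eq_sub_of_add_eq rfl))
  simp only [zero_smul, add_zero] at e₁ e₂
  have heq : ((starRingEnd ℂ) (P.φ x₀) * D1 P.a1 (D1 P.a1 P.φ) x₀).re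
      + ((starRingEnd ℂ) (P.φ x₀) * D2 P.a2 (D2 P.a2 P.φ) x₀).re
      = -((α - β * ‖P.φ x₀‖ ^ 2) * ‖P.φ x₀‖ ^ 2) := by
    rw [← Complex.add_re, ← mul_add, ← neg_neg (D1 _ _ _ + _), hP.2.2 x₀]
    have : (starRingEnd ℂ) (P.φ x₀) *
        -((α : ℂ) * P.φ x₀ - (β : ℂ) * (‖P.φ x₀‖ : ℂ) ^ 2 * P.φ x₀)
        = ((-((α - β * ‖P.φ x₀‖ ^ 2) * ‖P.φ x₀‖ ^ 2) : ℝ) : ℂ) := by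
      push_cast
      rw [← conj_mul' (P.φ x₀)]
      ring
    rw [this, ofReal_re]
  intro x
  refine (hx₀ x).trans (Real.le_sqrt_of_sq_le ?_)
  rw [le_div_iff₀ hβ]
  by_contra! hlt
  have hpos : 0 < ‖P.φ x₀‖ ^ 2 := by
    by_contra! h
    nlinarith
  nlinarith [sq_nonneg ‖D1 P.a1 P.φ x₀‖, sq_nonneg ‖D2 P.a2 P.φ x₀‖]
end
end

section
/- Let U ⊆ ℝ² be open, let α, β > 0, and let a = (a₁,a₂) : U → ℝ² and φ : U → ℂ be smooth. Write D_kφ = ∂_kφ + i a_k φ and D_k(D_kφ) = ∂_k(D_kφ) + i a_k D_kφ for k = 1,2. If −(D₁D₁φ + D₂D₂φ) = αφ − β|φ|²φ on U, then the function w = α/(2β) − |φ|²/2 satisfies, at every point of U, −(∂₁∂₁w + ∂₂∂₂w) + 2β|φ|²·w = |D₁φ|² + |D₂φ|². -/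
open MeasureTheory Complex

noncomputable section

/-- Covariant Leibniz rule: along `v`, with `D = ∂ᵥ + i a`, one has
`∂ᵥ∂ᵥ(c - |φ|²/2) = -(|Dφ|² + Re (DDφ * conj φ))`. -/
theorem fderiv_fderiv_const_sub_half_norm_sq {E : Type*} [NormedAddCommGroup E] [NormedSpace ℝ E]
    {a : E → ℝ} {φ : E → ℂ} {x : E} (v : E) (c : ℝ)
    (ha : DifferentiableAt ℝ a x) (hφ : ContDiffAt ℝ 2 φ x) :
    fderiv ℝ (fun y => fderiv ℝ (fun z => c - ‖φ z‖ ^ 2 / 2) y v) x v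
      = -(‖fderiv ℝ φ x v + I * (a x : ℂ) * φ x‖ ^ 2
        + ((fderiv ℝ (fun y => fderiv ℝ φ y v + I * (a y : ℂ) * φ y) x v
          + I * (a x : ℂ) * (fderiv ℝ φ x v + I * (a x : ℂ) * φ x))
            * (starRingEnd ℂ) (φ x)).re) := by
  have hφx : HasFDerivAt φ (fderiv ℝ φ x) x :=
    (hφ.differentiableAt (by norm_num)).hasFDerivAt
  have hdφ : HasFDerivAt (fun y => fderiv ℝ φ y v)
      (fderiv ℝ (fun y => fderiv ℝ φ y v) x) x :=
    (((hφ.fderiv_right (m := 1) (by norm_num)).differentiableAt (by norm_num)).clm_apply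
      (differentiableAt_const v)).hasFDerivAt
  have hfirst : (fun y => fderiv ℝ (fun z => c - ‖φ z‖ ^ 2 / 2) y v)
      =ᶠ[nhds x] fun y => -inner ℝ (φ y) (fderiv ℝ φ y v) := by
    filter_upwards [hφ.eventually (by simp)] with y hy
    have hd := (hy.differentiableAt (by norm_num)).hasFDerivAt.norm_sq
    have hw := (hd.mul_const (2⁻¹ : ℝ)).const_sub c
    simp only [div_eq_mul_inv]
    rw [hw.fderiv]
    simp
    ring
  have hleft : HasFDerivAt (fun y => -inner ℝ (φ y) (fderiv ℝ φ y v)) _ x :=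
    (hφx.inner ℝ hdφ).neg
  have haC : HasFDerivAt (fun y => (a y : ℂ)) (ofRealCLM.comp (fderiv ℝ a x)) x :=
    ofRealCLM.hasFDerivAt.comp x ha.hasFDerivAt
  have hright : HasFDerivAt (fun y => fderiv ℝ φ y v + I * (a y : ℂ) * φ y) _ x :=
    hdφ.add ((haC.const_mul I).mul hφx)
  rw [hfirst.fderiv_eq, hleft.fderiv, hright.fderiv]
  simp [Complex.inner, ← normSq_eq_norm_sq, normSq_apply]
  ring

/-- if `−(D₁D₁φ + D₂D₂φ) = αφ − β|φ|²φ` on an open set `U`, then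
`w = α/(2β) − |φ|²/2` satisfies `−Δw + 2β|φ|² w = |D₁φ|² + |D₂φ|²` on `U`. -/
theorem statement9 (U : Set (ℝ × ℝ)) (hU : IsOpen U) (α β : ℝ) (hα : 0 < α) (hβ : 0 < β)
    (a1 a2 : ℝ × ℝ → ℝ) (φ : ℝ × ℝ → ℂ)
    (ha1 : ContDiffOn ℝ (⊤ : ℕ∞) a1 U) (ha2 : ContDiffOn ℝ (⊤ : ℕ∞) a2 U) (hφ : ContDiffOn ℝ (⊤ : ℕ∞) φ U)
    (heq : ∀ x ∈ U, -(D1 a1 (D1 a1 φ) x + D2 a2 (D2 a2 φ) x)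
        = (α : ℂ) * φ x - (β : ℂ) * (‖φ x‖ : ℂ) ^ 2 * φ x) :
    ∀ x ∈ U,
      -(pd1 (pd1 (fun y => α / (2 * β) - ‖φ y‖ ^ 2 / 2)) x
          + pd2 (pd2 (fun y => α / (2 * β) - ‖φ y‖ ^ 2 / 2)) x)
        + 2 * β * ‖φ x‖ ^ 2 * (α / (2 * β) - ‖φ x‖ ^ 2 / 2)
      = ‖D1 a1 φ x‖ ^ 2 + ‖D2 a2 φ x‖ ^ 2 := by
  intro x hx
  have hxU : U ∈ nhds x := hU.mem_nhds hx
  have hφx : ContDiffAt ℝ 2 φ x := (hφ.contDiffAt hxU).of_le (WithTop.coe_le_coe.2 (le_top : (2 : ℕ∞) ≤ ⊤))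
  have h1 := fderiv_fderiv_const_sub_half_norm_sq (1, 0) (α / (2 * β))
    ((ha1.contDiffAt hxU).differentiableAt (by simp)) hφx
  have h2 := fderiv_fderiv_const_sub_half_norm_sq (0, 1) (α / (2 * β))
    ((ha2.contDiffAt hxU).differentiableAt (by simp)) hφx
  change pd1 (pd1 _) x = -(‖D1 a1 φ x‖ ^ 2
    + (D1 a1 (D1 a1 φ) x * (starRingEnd ℂ) (φ x)).re) at h1
  change pd2 (pd2 _) x = -(‖D2 a2 φ x‖ ^ 2
    + (D2 a2 (D2 a2 φ) x * (starRingEnd ℂ) (φ x)).re) at h2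
  have hre : -((D1 a1 (D1 a1 φ) x * (starRingEnd ℂ) (φ x)).re
      + (D2 a2 (D2 a2 φ) x * (starRingEnd ℂ) (φ x)).re)
      = α * ‖φ x‖ ^ 2 - β * ‖φ x‖ ^ 4 := by
    have key : -(D1 a1 (D1 a1 φ) x + D2 a2 (D2 a2 φ) x) * (starRingEnd ℂ) (φ x)
        = ((α * ‖φ x‖ ^ 2 - β * ‖φ x‖ ^ 4 : ℝ) : ℂ) := by
      rw [heq x hx]
      push_cast
      linear_combination ((α : ℂ) - β * (‖φ x‖ : ℂ) ^ 2) * mul_conj' (φ x)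
    rw [← add_re, ← add_mul, ← neg_re, ← neg_mul, key, ofReal_re]
  have hw : 2 * β * ‖φ x‖ ^ 2 * (α / (2 * β) - ‖φ x‖ ^ 2 / 2)
      = α * ‖φ x‖ ^ 2 - β * ‖φ x‖ ^ 4 := by
    field_simp
  rw [h1, h2, hw]
  linarith
end
end
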